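/- Theorem 2.1: Let X be a compact subset of R^k containing k linearly independent vectors, let c in R^k be nonzero, and assume that any linearly independent collection x_1, ..., x_l in X with l < k can be completed to a linearly independent set x_1, ..., x_l, x_{l+1}, ..., x_k of size k with all members in X. For a linearly independent k-tuple (x_1, ..., x_k) in X^k, the matrix M = (1/k) * sum_{i=1}^k x_i x_i^T is invertible; with d = M^{-1} c, define eps_i* = sign(x_i^T d), p_i* = |x_i^T d| / sum_j |x_j^T d|, z*(x_1, ..., x_k) = sum_i eps_i* p_i* x_i, and phi(x_1, ..., x_k) = ||z*(x_1, ..., x_k)||^2. Suppose (x_1*, ..., x_k*) maximizes phi over the set S of all linearly independent k-tuples from X. Then the design xi* = {(x_i*, p_i*(x_1*, ..., x_k*))}_{i=1}^k is c-optimal: c is estimable under xi*, and Psi(xi*) <= Psi(eta) for every finitely supported design eta on X under which c is estimable. -/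

import Mathlib

open Matrix BigOperators

/-- The information matrix of a design with points `x i` and weights `p i`. -/
noncomputable def infoMat {k n : ℕ} (x : Fin n → Fin k → ℝ) (p : Fin n → ℝ) :
    Matrix (Fin k) (Fin k) ℝ :=
  ∑ i, p i • vecMulVec (x i) (x i)

/-- The optimal sign `ε_i* = sign(x_iᵀ d)`, where `d` solves `M d = c`. -/
noncomputable def epsStar {k l : ℕ} (x : Fin l → Fin k → ℝ) (d : Fin k → ℝ) (i : Fin l) : ℝ :=
  Real.sign (x i ⬝ᵥ d)

/-- The optimal weight `p_i* = |x_iᵀ d| / ∑ j |x_jᵀ d|`, where `d` solves `M d = c`. -/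
noncomputable def pStar {k l : ℕ} (x : Fin l → Fin k → ℝ) (d : Fin k → ℝ) (i : Fin l) : ℝ :=
  |x i ⬝ᵥ d| / ∑ j, |x j ⬝ᵥ d|

/-- The Elfving point `z* = ∑ i ε_i* p_i* x_i`; `φ(x₁,…,x_k) = ‖z*‖² = z* ⬝ᵥ z*`. -/
noncomputable def zStar {k l : ℕ} (x : Fin l → Fin k → ℝ) (d : Fin k → ℝ) : Fin k → ℝ :=
  ∑ i, (epsStar x d i * pStar x d i) • x i

/-- Basic solutions: a linear combination can be rewritten with coefficients of no larger `ℓ¹` norm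
that are supported on a linearly independent subfamily. -/
lemma exists_linearIndepOn_support {ι E : Type*} [Fintype ι] [AddCommGroup E] [Module ℝ E]
    (y : ι → E) (b : ι → ℝ) :
    ∃ b' : ι → ℝ, LinearIndepOn ℝ y {i | b' i ≠ 0} ∧ ∑ i, b' i • y i = ∑ i, b i • y i ∧
      ∑ i, |b' i| ≤ ∑ i, |b i| := by
  classical
  induction hn : (Finset.univ.filter fun i => b i ≠ 0).card using Nat.strong_induction_on
    generalizing b with
  | _ n ih =>
  by_cases hli : LinearIndepOn ℝ y {i | b i ≠ 0}
  · exact ⟨b, hli, rfl, le_rfl⟩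
  have hdep : ∃ g : ι → ℝ, (∀ i, b i = 0 → g i = 0) ∧ ∑ i, g i • y i = 0 ∧ (∃ i, g i ≠ 0) ∧
      0 ≤ ∑ i, (b i).sign * g i := by
    have hset : {i | b i ≠ 0} = ((Finset.univ.filter fun i => b i ≠ 0 : Finset ι) : Set ι) := by
      ext; simp
    rw [hset, not_linearIndepOn_finset_iff] at hli
    obtain ⟨f, hf, j, hj, hfj⟩ := hli
    have hj' : b j ≠ 0 := by simpa using hj
    let g : ι → ℝ := fun i => if b i ≠ 0 then f i else 0
    have hg0 : ∀ i, b i = 0 → g i = 0 := fun i hi => by simp [g, hi]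
    have hgy : ∑ i, g i • y i = 0 := by
      rw [← hf, Finset.sum_filter]
      exact Finset.sum_congr rfl fun i _ => by simp only [g]; split_ifs <;> simp
    have hgj : g j ≠ 0 := by simpa [g, hj'] using hfj
    rcases le_total 0 (∑ i, (b i).sign * g i) with h | h
    · exact ⟨g, hg0, hgy, ⟨j, hgj⟩, h⟩
    · exact ⟨fun i => -g i, fun i hi => by simp [hg0 i hi], by simp [hgy],
        ⟨j, by simpa using hgj⟩, by simpa using h⟩
  obtain ⟨g, hg0, hgy, ⟨j, hgj⟩, hsum⟩ := hdep
  have hne : (Finset.univ.filter fun i => 0 < (b i).sign * g i).Nonempty := by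
    by_contra hempty
    rw [Finset.not_nonempty_iff_eq_empty, Finset.filter_eq_empty_iff] at hempty
    have hle : ∀ i ∈ Finset.univ, (b i).sign * g i ≤ 0 := fun i hi => not_lt.mp (hempty hi)
    have hz := (Finset.sum_eq_zero_iff_of_nonpos hle).mp
      (le_antisymm (Finset.sum_nonpos hle) hsum) j (Finset.mem_univ j)
    rcases mul_eq_zero.mp hz with h | h
    · exact hgj (hg0 j (Real.sign_eq_zero_iff.mp h))
    · exact hgj h
  obtain ⟨i₀, hi₀, hmin⟩ := Finset.exists_min_image _ (fun i => |b i| / ((b i).sign * g i)) hne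
  have hpos : 0 < (b i₀).sign * g i₀ := by simpa using hi₀
  set t := |b i₀| / ((b i₀).sign * g i₀) with ht
  have ht0 : 0 ≤ t := by positivity
  have hbound : ∀ i, t * ((b i).sign * g i) ≤ |b i| := fun i => by
    rcases lt_or_ge 0 ((b i).sign * g i) with h | h
    · exact (le_div_iff₀ h).mp (hmin i (by simpa using h))
    · exact (mul_nonpos_of_nonneg_of_nonpos ht0 h).trans (abs_nonneg _)
  have habs : ∀ i, |b i - t * g i| = |b i| - t * ((b i).sign * g i) := fun i => by
    have h := hbound i
    rcases lt_trichotomy (b i) 0 with hb | hb | hb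
    · rw [Real.sign_of_neg hb, abs_of_neg hb] at *
      rw [abs_of_nonpos] <;> linarith
    · simp [hb, hg0 i hb]
    · rw [Real.sign_of_pos hb, abs_of_pos hb] at *
      rw [abs_of_nonneg] <;> linarith
  have hi₀z : b i₀ - t * g i₀ = 0 := by
    rw [← abs_eq_zero, habs, ht, div_mul_cancel₀ _ hpos.ne', sub_self]
  have hcard : (Finset.univ.filter fun i => b i - t * g i ≠ 0).card < n := by
    rw [← hn]
    refine Finset.card_lt_card ((Finset.ssubset_iff_of_subset fun i hi => ?_).mpr ⟨i₀, ?_, ?_⟩)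
    · simp only [Finset.mem_filter, Finset.mem_univ, true_and] at hi ⊢
      exact fun hb => hi (by simp [hb, hg0 i hb])
    · simp only [Finset.mem_filter, Finset.mem_univ, true_and]
      exact fun hb => hpos.ne' (by simp [hb])
    · simp [hi₀z]
  obtain ⟨b', hli', hsum', hle'⟩ := ih _ hcard (fun i => b i - t * g i) rfl
  refine ⟨b', hli', hsum'.trans ?_, hle'.trans ?_⟩
  · simp only [sub_smul, mul_smul, Finset.sum_sub_distrib]
    rw [← Finset.smul_sum, hgy, smul_zero, sub_zero]
  · simp only [habs, Finset.sum_sub_distrib]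
    rw [← Finset.mul_sum]
    exact sub_le_self _ (mul_nonneg ht0 hsum)

lemma exists_dotProduct_eq {k : ℕ} {x : Fin k → Fin k → ℝ} (hx : LinearIndependent ℝ x)
    (w : Fin k → ℝ) : ∃ d : Fin k → ℝ, ∀ i, x i ⬝ᵥ d = w i := by
  have hu : IsUnit (Matrix.of x) := Matrix.linearIndependent_rows_iff_isUnit.mp hx
  obtain ⟨d, hd⟩ := (Matrix.mulVec_surjective_iff_isUnit.mpr hu) w
  exact ⟨d, fun i => congrFun hd i⟩

lemma infoMat_mulVec {k n : ℕ} (x : Fin n → Fin k → ℝ) (p : Fin n → ℝ) (d : Fin k → ℝ) :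
    infoMat x p *ᵥ d = ∑ i, (p i * (x i ⬝ᵥ d)) • x i := by
  simp [infoMat, Matrix.sum_mulVec, Matrix.smul_mulVec, Matrix.vecMulVec_mulVec, mul_smul]

lemma uniform_infoMat_mulVec {k : ℕ} (x : Fin k → Fin k → ℝ) (d : Fin k → ℝ) :
    ((k : ℝ)⁻¹ • ∑ i, vecMulVec (x i) (x i)) *ᵥ d = ∑ i, ((k : ℝ)⁻¹ * (x i ⬝ᵥ d)) • x i := by
  rw [← infoMat_mulVec x fun _ => (k : ℝ)⁻¹, infoMat, Finset.smul_sum]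

lemma LinearIndependent.coeff_ext {ι E : Type*} [Fintype ι] [AddCommGroup E] [Module ℝ E]
    {x : ι → E} (hx : LinearIndependent ℝ x) {a b : ι → ℝ}
    (h : ∑ i, a i • x i = ∑ i, b i • x i) (i : ι) : a i = b i := by
  have := Fintype.linearIndependent_iff.mp hx (fun i => a i - b i)
    (by simp [sub_smul, Finset.sum_sub_distrib, h]) i
  linarith

lemma pStar_eq {k l : ℕ} {x : Fin l → Fin k → ℝ} {d : Fin k → ℝ} {a : Fin l → ℝ} {r : ℝ}
    (hr : 0 < r) (h : ∀ i, x i ⬝ᵥ d = r * a i) (i : Fin l) :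
    pStar x d i = |a i| / ∑ j, |a j| := by
  simp only [pStar, h, abs_mul, abs_of_pos hr, ← Finset.mul_sum]
  rw [mul_div_mul_left _ _ hr.ne']

lemma zStar_eq {k l : ℕ} {x : Fin l → Fin k → ℝ} {d : Fin k → ℝ} {a : Fin l → ℝ} {r : ℝ}
    (hr : 0 < r) (h : ∀ i, x i ⬝ᵥ d = r * a i) :
    zStar x d = (∑ j, |a j|)⁻¹ • ∑ i, a i • x i := by
  rw [zStar, Finset.smul_sum]
  refine Finset.sum_congr rfl fun i _ => ?_
  have hsign : Real.sign (r * a i) * |a i| = a i := by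
    rcases lt_trichotomy (a i) 0 with ha | ha | ha
    · rw [Real.sign_of_neg (mul_neg_of_pos_of_neg hr ha), abs_of_neg ha]; ring
    · simp [ha]
    · rw [Real.sign_of_pos (mul_pos hr ha), abs_of_pos ha, one_mul]
  rw [pStar_eq hr h, epsStar, h, smul_smul, ← mul_div_assoc, hsign, div_eq_inv_mul]

lemma sum_abs_pos {ι E : Type*} [Fintype ι] [AddCommGroup E] [Module ℝ E] {x : ι → E}
    {a : ι → ℝ} (h : ∑ i, a i • x i ≠ 0) : 0 < ∑ i, |a i| := by
  refine (Finset.sum_nonneg fun i _ => abs_nonneg _).lt_of_ne' fun h0 => h ?_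
  have hz := (Finset.sum_eq_zero_iff_of_nonneg fun i _ => abs_nonneg (a i)).mp h0
  exact Finset.sum_eq_zero fun i hi => by rw [abs_eq_zero.mp (hz i hi), zero_smul]

/-- If linearly independent tuples in `X` extend to `k`-tuples, then every representation of a vector
over `X` yields one over a linearly independent `k`-tuple whose `ℓ¹` norm is no larger. -/
lemma exists_basis_representation {k m : ℕ} {X : Set (Fin k → ℝ)}
    (hcomplete : ∀ (l : ℕ) (hl : l < k) (x : Fin l → Fin k → ℝ),
      (∀ i, x i ∈ X) → LinearIndependent ℝ x →
      ∃ y : Fin k → Fin k → ℝ, (∀ i, y i ∈ X) ∧ LinearIndependent ℝ y ∧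
        ∀ i : Fin l, y (Fin.castLE hl.le i) = x i)
    (y : Fin m → Fin k → ℝ) (hy : ∀ i, y i ∈ X) (b : Fin m → ℝ) :
    ∃ (x : Fin k → Fin k → ℝ) (a : Fin k → ℝ), (∀ i, x i ∈ X) ∧ LinearIndependent ℝ x ∧
      ∑ i, a i • x i = ∑ i, b i • y i ∧ ∑ i, |a i| ≤ ∑ i, |b i| := by
  classical
  obtain ⟨b', hli, hsum, hle⟩ := exists_linearIndepOn_support y b
  let e := Fintype.equivFin {i | b' i ≠ 0}
  have hli' : LinearIndependent ℝ fun j => y (e.symm j) := hli.comp _ e.symm.injective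
  have hcard : Fintype.card {i | b' i ≠ 0} ≤ k := by
    simpa using hli'.fintype_card_le_finrank
  obtain ⟨x, hxX, hxli, hx⟩ : ∃ x : Fin k → Fin k → ℝ, (∀ i, x i ∈ X) ∧ LinearIndependent ℝ x ∧
      ∀ j, x (Fin.castLE hcard j) = y (e.symm j) := by
    rcases hcard.lt_or_eq with h | h
    · exact hcomplete _ h _ (fun j => hy _) hli'
    · exact ⟨fun j => y (e.symm (Fin.cast h.symm j)), fun j => hy _,
        hli'.comp _ (Fin.cast_injective h.symm), fun j => rfl⟩
  have hsupp : ∀ {F : Type} [AddCommMonoid F] (f : Fin m → F), (∀ i, b' i = 0 → f i = 0) →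
      ∑ j, f (e.symm j) = ∑ i, f i := fun f hf => by
    rw [e.symm.sum_comp fun i : {i | b' i ≠ 0} => f i, ← Finset.sum_subtype
      (Finset.univ.filter fun i => b' i ≠ 0) (p := (· ∈ {i | b' i ≠ 0})) (by simp) f]
    exact Finset.sum_filter_of_ne fun i _ hi hb => hi (hf i hb)
  refine ⟨x, fun i => ∑ j, if Fin.castLE hcard j = i then b' (e.symm j) else 0, hxX, hxli, ?_, ?_⟩
  · simp only [Finset.sum_smul, ite_smul, zero_smul]
    rw [Finset.sum_comm, ← hsum, ← hsupp (fun i => b' i • y i) fun i hi => by simp [hi]]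
    simp [hx]
  · refine le_trans (Finset.sum_le_sum fun i _ => Finset.abs_sum_le_sum_abs _ _) ?_
    rw [Finset.sum_comm]
    refine le_trans (le_of_eq ?_) hle
    rw [← hsupp (fun i => |b' i|) fun i hi => by simp [hi]]
    simp [apply_ite abs]

/-- Theorem 2.1: let `X ⊆ ℝᵏ` be compact, containing `k` linearly
independent vectors, such that any linearly independent collection of `l < k` points of
`X` can be completed to a linearly independent `k`-tuple of points of `X`.  Let `c ≠ 0`.
For a linearly independent `k`-tuple `(x₁,…,x_k)` from `X`, `M = (1/k) ∑ i x_i x_iᵀ` is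
invertible; with `d = M⁻¹ c` (equivalently, any solution of `M d = c`), define `ε_i*`,
`p_i*`, `z*`, and `φ = ‖z*‖²`.  If `(x₁*,…,x_k*)` maximizes `φ` over linearly independent
`k`-tuples from `X` then `ξ* = {(x_i*, p_i*)}` is `c`-optimal: `c` is estimable under
`ξ*`, and `Ψ(ξ*) ≤ Ψ(η)` for every finitely supported design `η` on `X` under which `c`
is estimable.  Here `Ψ(ξ) = cᵀ d` for any `d` with `M(ξ) d = c`. -/
theorem theorem_2_1 {k : ℕ} (hk : 1 ≤ k)
    (X : Set (Fin k → ℝ)) (hX : IsCompact X)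
    (hXfull : ∃ x : Fin k → Fin k → ℝ, (∀ i, x i ∈ X) ∧ LinearIndependent ℝ x)
    (hcomplete : ∀ (l : ℕ) (hl : l < k) (x : Fin l → Fin k → ℝ),
      (∀ i, x i ∈ X) → LinearIndependent ℝ x →
      ∃ y : Fin k → Fin k → ℝ, (∀ i, y i ∈ X) ∧ LinearIndependent ℝ y ∧
        ∀ i : Fin l, y (Fin.castLE hl.le i) = x i)
    (c : Fin k → ℝ) (hc : c ≠ 0)
    (xs : Fin k → Fin k → ℝ) (hxsX : ∀ i, xs i ∈ X) (hxsLI : LinearIndependent ℝ xs)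
    (ds : Fin k → ℝ)
    (hds : ((k : ℝ)⁻¹ • ∑ i, vecMulVec (xs i) (xs i)) *ᵥ ds = c)
    (hmax : ∀ y : Fin k → Fin k → ℝ, (∀ i, y i ∈ X) → LinearIndependent ℝ y →
      ∀ e : Fin k → ℝ, ((k : ℝ)⁻¹ • ∑ i, vecMulVec (y i) (y i)) *ᵥ e = c →
        zStar y e ⬝ᵥ zStar y e ≤ zStar xs ds ⬝ᵥ zStar xs ds) :
    (∃ e : Fin k → ℝ, (infoMat xs (pStar xs ds)) *ᵥ e = c) ∧
    ∀ (m : ℕ) (y : Fin m → Fin k → ℝ) (q : Fin m → ℝ),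
      (∀ i, y i ∈ X) → (∀ i, 0 ≤ q i) → ∑ i, q i = 1 →
      ∀ e : Fin k → ℝ, (infoMat y q) *ᵥ e = c →
        ∀ d : Fin k → ℝ, (infoMat xs (pStar xs ds)) *ᵥ d = c →
          c ⬝ᵥ d ≤ c ⬝ᵥ e := by
  have hk0 : (0 : ℝ) < k := by exact_mod_cast hk
  rw [uniform_infoMat_mulVec] at hds
  obtain ⟨a, ha⟩ : ∃ a : Fin k → ℝ, ∀ i, a i = (k : ℝ)⁻¹ * (xs i ⬝ᵥ ds) := ⟨_, fun _ => rfl⟩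
  simp only [← ha] at hds
  have hxa : ∀ i, xs i ⬝ᵥ ds = k * a i := fun i => by simp [ha, hk0.ne']
  have hT : 0 < ∑ i, |a i| := sum_abs_pos (hds.trans_ne hc)
  have hp := pStar_eq hk0 hxa
  set T := ∑ i, |a i| with hTdef
  have hcdot : ∀ d, c ⬝ᵥ d = ∑ i, a i * (xs i ⬝ᵥ d) := fun d => by
    simp [← hds, sum_dotProduct, smul_dotProduct]
  refine ⟨?_, fun m y q hyX hq hq1 e he d hd => ?_⟩
  · obtain ⟨d, hd⟩ := exists_dotProduct_eq hxsLI fun i => T * Real.sign (a i)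
    refine ⟨d, ?_⟩
    rw [infoMat_mulVec, ← hds]
    refine Finset.sum_congr rfl fun i _ => ?_
    congr 1
    rw [hp, hd]
    rcases lt_trichotomy (a i) 0 with h | h | h
    · rw [Real.sign_of_neg h, abs_of_neg h]; field_simp
    · simp [h]
    · rw [Real.sign_of_pos h, abs_of_pos h]; field_simp
  have hcd : c ⬝ᵥ d = T ^ 2 := by
    rw [infoMat_mulVec, ← hds] at hd
    have hcoef := hxsLI.coeff_ext hd
    rw [hcdot, sq, hTdef, Finset.sum_mul, ← hTdef]
    refine Finset.sum_congr rfl fun i _ => ?_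
    have h := hcoef i
    rw [hp] at h
    rcases eq_or_ne (a i) 0 with h0 | h0
    · simp [h0]
    · have habs : |a i| ≠ 0 := abs_ne_zero.mpr h0
      have hv : |a i| * (xs i ⬝ᵥ d) = a i * T := by
        rwa [div_mul_eq_mul_div, div_eq_iff hT.ne'] at h
      apply mul_left_cancel₀ habs
      calc |a i| * (a i * (xs i ⬝ᵥ d)) = a i * (|a i| * (xs i ⬝ᵥ d)) := by ring
        _ = (a i * a i) * T := by rw [hv]; ring
        _ = |a i| * (|a i| * T) := by rw [← abs_mul_abs_self (a i)]; ring
  rw [infoMat_mulVec] at he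
  obtain ⟨x, α, hxX, hxli, hxα, hle⟩ := exists_basis_representation hcomplete y hyX
    fun i => q i * (y i ⬝ᵥ e)
  rw [he] at hxα
  obtain ⟨f, hf⟩ := exists_dotProduct_eq hxli fun i => k * α i
  have hphi := hmax x hxX hxli f (by
    rw [uniform_infoMat_mulVec, ← hxα]
    exact Finset.sum_congr rfl fun i _ => by rw [hf, inv_mul_cancel_left₀ hk0.ne'])
  have hS : 0 < ∑ i, |α i| := sum_abs_pos (hxα.trans_ne hc)
  have hcc : 0 < c ⬝ᵥ c := by
    simpa using dotProduct_star_self_pos_iff.mpr hc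
  have hTS : T ≤ ∑ i, |α i| := by
    rw [zStar_eq hk0 hf, zStar_eq hk0 hxa, hxα, hds] at hphi
    simp only [smul_dotProduct, dotProduct_smul, smul_eq_mul, ← mul_assoc] at hphi
    have h := le_of_mul_le_mul_right hphi hcc
    exact (inv_le_inv₀ hS hT).mp (nonneg_le_nonneg_of_sq_le_sq (inv_nonneg.mpr hT.le) h)
  have hce : c ⬝ᵥ e = ∑ i, q i * (y i ⬝ᵥ e) ^ 2 := by
    nth_rewrite 1 [← he]
    simp only [sum_dotProduct, smul_dotProduct, smul_eq_mul]
    exact Finset.sum_congr rfl fun i _ => by ring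
  have hjensen : (∑ i, |q i * (y i ⬝ᵥ e)|) ^ 2 ≤ ∑ i, q i * (y i ⬝ᵥ e) ^ 2 := by
    have h := Real.pow_arith_mean_le_arith_mean_pow Finset.univ q (fun i => |y i ⬝ᵥ e|)
      (fun i _ => hq i) hq1 (fun i _ => abs_nonneg _) 2
    simpa only [abs_mul, abs_of_nonneg (hq _), sq_abs] using h
  rw [hcd, hce]
  exact (pow_le_pow_left₀ hT.le (hTS.trans hle) 2).trans hjensen
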